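/- Suppose S ⊆ W satisfies d(S, G_1) = d(S, G_2) = (k − 1)/4, and write S = {inl v : v ∈ W₀} ∪ {inr i : i ∈ T₀} with W₀ ⊆ V_H and T₀ ⊆ Fin k. Then |W₀| = |T₀| = k (so that T₀ = Fin k) and W₀ is a k-clique in H. -/

import Mathlib

/-- Number of edges of `G` with both endpoints in `S`. -/
noncomputable def edgeCnt {W : Type*} (G : SimpleGraph W) (S : Finset W) : ℕ :=
  {e ∈ G.edgeSet | ∀ v ∈ e, v ∈ S}.ncard

/-- Density of the subgraph induced by `S` in `G`. -/
noncomputable def dens {W : Type*} (G : SimpleGraph W) (S : Finset W) : ℝ :=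
  (edgeCnt G S : ℝ) / (S.card : ℝ)

/-- The first snapshot: a copy of `H` on the `inl` vertices, the `k` new
vertices being isolated. -/
def G1 {VH : Type*} (H : SimpleGraph VH) (k : ℕ) : SimpleGraph (VH ⊕ Fin k) :=
  SimpleGraph.fromRel (fun a b => ∃ u v, a = Sum.inl u ∧ b = Sum.inl v ∧ H.Adj u v)

/-- The second snapshot: a `k`-clique on the `inr` vertices, the vertices of
`VH` being isolated. -/
def G2 (VH : Type*) (k : ℕ) : SimpleGraph (VH ⊕ Fin k) :=
  SimpleGraph.fromRel (fun a b => ∃ i j : Fin k, a = Sum.inr i ∧ b = Sum.inr j)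

theorem edgeSet_inside_subset {W : Type*} [DecidableEq W] {G : SimpleGraph W} {S T : Finset W}
    (h : ∀ u ∈ S, ∀ v ∈ S, G.Adj u v → u ∈ T ∧ v ∈ T) :
    {e ∈ G.edgeSet | ∀ v ∈ e, v ∈ S} ⊆ (T.offDiag.image Sym2.mk.uncurry : Finset (Sym2 W)) := by
  intro e
  induction e with | _ u v =>
  simp only [Set.mem_ofPred_eq, SimpleGraph.mem_edgeSet, Sym2.mem_iff, forall_eq_or_imp,
    forall_eq]
  rintro ⟨huv, hu, hv⟩
  obtain ⟨hu', hv'⟩ := h u hu v hv huv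
  exact Finset.mem_coe.2 (Finset.mem_image.2
    ⟨(u, v), Finset.mem_offDiag.2 ⟨hu', hv', huv.ne⟩, rfl⟩)

/-- If all edges of `G` inside `S` lie inside `T`, there are at most `T.card.choose 2` of them. -/
theorem edgeCnt_le_choose {W : Type*} [DecidableEq W] {G : SimpleGraph W} {S T : Finset W}
    (h : ∀ u ∈ S, ∀ v ∈ S, G.Adj u v → u ∈ T ∧ v ∈ T) :
    edgeCnt G S ≤ T.card.choose 2 := by
  rw [← Sym2.card_image_offDiag, ← Set.ncard_coe_finset]
  exact Set.ncard_le_ncard (edgeSet_inside_subset h) (Finset.finite_toSet _)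

theorem edgeCnt_eq_choose_iff {W : Type*} [DecidableEq W] {G : SimpleGraph W} {S T : Finset W}
    (hTS : T ⊆ S) (h : ∀ u ∈ S, ∀ v ∈ S, G.Adj u v → u ∈ T ∧ v ∈ T) :
    edgeCnt G S = T.card.choose 2 ↔ G.IsClique T := by
  rw [← Sym2.card_image_offDiag, ← Set.ncard_coe_finset]
  constructor
  · intro hcard u hu v hv huv
    have heq := Set.eq_of_subset_of_ncard_le (edgeSet_inside_subset h) hcard.ge
      (Finset.finite_toSet _)
    have hmem : s(u, v) ∈ (T.offDiag.image Sym2.mk.uncurry : Finset (Sym2 W)) :=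
      Finset.mem_image.2 ⟨(u, v), Finset.mem_offDiag.2 ⟨hu, hv, huv⟩, rfl⟩
    rw [← Finset.mem_coe, ← heq] at hmem
    exact hmem.1
  · intro hT
    refine congrArg Set.ncard ((edgeSet_inside_subset h).antisymm ?_)
    intro e he
    obtain ⟨⟨u, v⟩, huv, rfl⟩ := Finset.mem_image.1 (Finset.mem_coe.1 he)
    obtain ⟨hu, hv, hne⟩ := Finset.mem_offDiag.1 huv
    refine ⟨hT hu hv hne, fun w hw => ?_⟩
    rcases Sym2.mem_iff.1 hw with rfl | rfl
    exacts [hTS hu, hTS hv]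

/-- If `a + b` vertices carry `m ≤ a.choose 2` and `b.choose 2` edges, both of density
`(k - 1) / 4`, and `b ≤ k`, then `a = b = k`. -/
theorem eq_of_density_eq {a b k m : ℕ} (hk : 2 ≤ k) (hb : b ≤ k) (hm : m ≤ a.choose 2)
    (h1 : (m : ℝ) / ((a + b : ℕ) : ℝ) = ((k : ℝ) - 1) / 4)
    (h2 : (b.choose 2 : ℝ) / ((a + b : ℕ) : ℝ) = ((k : ℝ) - 1) / 4) :
    a = k ∧ b = k ∧ m = a.choose 2 := by
  have hkR : (2 : ℝ) ≤ k := by exact_mod_cast hk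
  have hbR : (b : ℝ) ≤ k := by exact_mod_cast hb
  have hn : ((a + b : ℕ) : ℝ) ≠ 0 := by
    intro h0
    rw [h0, div_zero] at h1
    linarith
  have hpos : (0 : ℝ) < a + b := by
    have : (0 : ℝ) < ((a + b : ℕ) : ℝ) := lt_of_le_of_ne (Nat.cast_nonneg _) hn.symm
    exact_mod_cast this
  have hmb : m = b.choose 2 := by
    have := h1.trans h2.symm
    rw [div_left_inj' hn] at this
    exact_mod_cast this
  rw [div_eq_iff hn, Nat.cast_choose_two, Nat.cast_add] at h2
  have hb0 : (0 : ℝ) < b := by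
    rcases Nat.eq_zero_or_pos b with rfl | hb0
    · norm_num at h2 hpos
      rcases h2 with h2 | h2
      · linarith
      · exact absurd h2 hpos.ne'
    · exact_mod_cast hb0
  have hab : (b : ℝ) ≤ a := by
    have hle : (b.choose 2 : ℝ) ≤ a.choose 2 := by exact_mod_cast hmb ▸ hm
    rw [Nat.cast_choose_two, Nat.cast_choose_two] at hle
    have hb1 : (1 : ℝ) < b := by nlinarith
    by_contra! hlt
    have ha0 : (0 : ℝ) ≤ a := Nat.cast_nonneg a
    nlinarith
  have hbk : b = k := by
    refine le_antisymm hb ?_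
    have : (k : ℝ) ≤ b := by
      by_contra! hlt
      nlinarith
    exact_mod_cast this
  subst hbk
  have hak : a = b := by
    have : (a : ℝ) = b := by nlinarith
    exact_mod_cast this
  exact ⟨hak, rfl, hak ▸ hmb⟩

theorem G1_adj_inl {VH : Type*} {H : SimpleGraph VH} {k : ℕ} {u v : VH} :
    (G1 H k).Adj (Sum.inl u) (Sum.inl v) ↔ H.Adj u v := by
  simp only [G1, SimpleGraph.fromRel_adj]
  constructor
  · rintro ⟨-, ⟨_, _, hu, hv, h⟩ | ⟨_, _, hv, hu, h⟩⟩ <;> cases hu <;> cases hv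
    exacts [h, h.symm]
  · exact fun h => ⟨fun he => h.ne (Sum.inl_injective he), .inl ⟨u, v, rfl, rfl, h⟩⟩

theorem exists_inl_of_G1_adj {VH : Type*} {H : SimpleGraph VH} {k : ℕ} {x y : VH ⊕ Fin k}
    (h : (G1 H k).Adj x y) : (∃ u, x = Sum.inl u) ∧ ∃ v, y = Sum.inl v := by
  rcases h with ⟨-, ⟨u, v, hu, hv, -⟩ | ⟨v, u, hv, hu, -⟩⟩ <;> exact ⟨⟨u, hu⟩, v, hv⟩

theorem exists_inr_of_G2_adj {VH : Type*} {k : ℕ} {x y : VH ⊕ Fin k}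
    (h : (G2 VH k).Adj x y) : (∃ i, x = Sum.inr i) ∧ ∃ j, y = Sum.inr j := by
  rcases h with ⟨-, ⟨i, j, hi, hj⟩ | ⟨j, i, hj, hi⟩⟩ <;> exact ⟨⟨i, hi⟩, j, hj⟩

theorem G2_isClique_image_inr {VH : Type*} [DecidableEq VH] {k : ℕ} (T : Finset (Fin k)) :
    (G2 VH k).IsClique (T.image (Sum.inr : Fin k → VH ⊕ Fin k) : Finset (VH ⊕ Fin k)) := by
  intro x hx y hy hxy
  obtain ⟨i, -, rfl⟩ := Finset.mem_image.1 hx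
  obtain ⟨j, -, rfl⟩ := Finset.mem_image.1 hy
  exact ⟨hxy, .inl ⟨i, j, rfl, rfl⟩⟩

theorem stmt19 {VH : Type*} [Fintype VH] [DecidableEq VH]
    (H : SimpleGraph VH) (k : ℕ) (hk : 2 ≤ k)
    (S : Finset (VH ⊕ Fin k)) (W₀ : Finset VH) (T₀ : Finset (Fin k))
    (hdecomp : S = W₀.image Sum.inl ∪ T₀.image Sum.inr)
    (h1 : dens (G1 H k) S = ((k : ℝ) - 1) / 4)
    (h2 : dens (G2 VH k) S = ((k : ℝ) - 1) / 4) :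
    W₀.card = k ∧ T₀.card = k ∧ T₀ = Finset.univ ∧ H.IsNClique k W₀ := by
  have hS1 : ∀ x ∈ S, ∀ y ∈ S, (G1 H k).Adj x y →
      x ∈ W₀.image Sum.inl ∧ y ∈ W₀.image Sum.inl := by
    subst hdecomp
    intro x hx y hy hxy
    obtain ⟨⟨u, rfl⟩, v, rfl⟩ := exists_inl_of_G1_adj hxy
    simpa using And.intro hx hy
  have hS2 : ∀ x ∈ S, ∀ y ∈ S, (G2 VH k).Adj x y →
      x ∈ T₀.image Sum.inr ∧ y ∈ T₀.image Sum.inr := by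
    subst hdecomp
    intro x hx y hy hxy
    obtain ⟨⟨i, rfl⟩, j, rfl⟩ := exists_inr_of_G2_adj hxy
    simpa using And.intro hx hy
  have hWS : W₀.image Sum.inl ⊆ S := hdecomp ▸ Finset.subset_union_left
  have hTS : T₀.image Sum.inr ⊆ S := hdecomp ▸ Finset.subset_union_right
  have hW : (W₀.image (Sum.inl : VH → VH ⊕ Fin k)).card = W₀.card :=
    Finset.card_image_of_injective _ Sum.inl_injective
  have hT : (T₀.image (Sum.inr : Fin k → VH ⊕ Fin k)).card = T₀.card :=
    Finset.card_image_of_injective _ Sum.inr_injective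
  have hcard : S.card = W₀.card + T₀.card := by
    rw [hdecomp, Finset.card_union_of_disjoint, hW, hT]
    simp [Finset.disjoint_left]
  have hTk : T₀.card ≤ k := by simpa using T₀.card_le_univ
  have hm1 := edgeCnt_le_choose hS1
  have hm2 := (edgeCnt_eq_choose_iff hTS hS2).2 (G2_isClique_image_inr T₀)
  rw [hW] at hm1
  rw [hT] at hm2
  rw [dens, hcard] at h1 h2
  rw [hm2] at h2
  obtain ⟨hWk, hTk, hm⟩ := eq_of_density_eq hk hTk hm1 h1 h2
  refine ⟨hWk, hTk, (Finset.card_eq_iff_eq_univ T₀).1 (by simpa using hTk), ?_, hWk⟩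
  rw [← hW] at hm
  have hclique := (edgeCnt_eq_choose_iff hWS hS1).1 hm
  intro u hu v hv huv
  exact G1_adj_inl.1 (hclique (Finset.mem_image_of_mem _ hu) (Finset.mem_image_of_mem _ hv)
    (Sum.inl_injective.ne huv))
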